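/- Fix real numbers η and β with β ∈ (0,1), η < 1, and (η + β)² − 4β > 0. Then both real roots λ₁, λ₂ of λ² − (η + β)λ + β = 0 satisfy max{|λ₁|, |λ₂|} < max{|η|, √β}. -/

import Mathlib

/-- If `β ∈ (0,1)`, `η < 1` and `(η + β)² − 4β > 0`, then every real root of
`λ² − (η + β)λ + β = 0` satisfies `|λ| < max {|η|, √β}`. -/
theorem stmt6 (η β : ℝ) (hβ0 : 0 < β) (hβ1 : β < 1) (hη : η < 1)
    (hdisc : 0 < (η + β) ^ 2 - 4 * β) :
    ∀ l : ℝ, l ^ 2 - (η + β) * l + β = 0 →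
      |l| < max |η| (Real.sqrt β) := by
  intro l hl
  refine lt_max_of_lt_left ?_
  -- `l` lies strictly between `η` and `β`.
  have hbetween : (l - η) * (l - β) < 0 := by
    nlinarith [mul_pos hβ0 (sub_pos.2 hη)]
  rcases lt_or_ge 0 η with h0 | h0
  · have hlt : β < η := by
      by_contra! h
      nlinarith
    rcases mul_neg_iff.1 hbetween with ⟨h1, h2⟩ | ⟨h1, h2⟩
    · linarith
    · rw [abs_of_pos h0, abs_of_pos (by linarith)]
      linarith
  · have hsum : η + β < 0 := by
      by_contra! h
      nlinarith
    have hneg : l < 0 := by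
      by_contra! h
      nlinarith [mul_nonneg h (neg_nonneg.2 hsum.le)]
    rcases mul_neg_iff.1 hbetween with ⟨h1, h2⟩ | ⟨h1, h2⟩
    · rw [abs_of_nonpos h0, abs_of_neg hneg]
      linarith
    · linarith
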